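/- arXiv:1701.06125 — 3 statements merged into one kernel-verified Lean document; each statement's English description precedes it below -/
import Mathlib

section
/- Let K be a field of characteristic zero, c ∈ K, φ the K-algebra endomorphism of K[x] mapping x to x + c, and δ = I - φ. Let u ∈ K[x] and I = uK[x]. If u = 0, or deg u ≤ 1, or u has at least one repeated root in an algebraic closure of K, then δ(I) is a Mathieu subspace of K[x]. -/
open Polynomial

/-- A `K`-subspace `V` of `K[x]` is a Mathieu subspace if for all `a, b ∈ K[x]` with
`a^m ∈ V` for all `m ≥ 1`, one has `a^m * b ∈ V` for all sufficiently large `m`. -/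
def IsMathieuSubspace {K : Type*} [Field K] (V : Submodule K (Polynomial K)) : Prop :=
  ∀ a b : Polynomial K, (∀ m : ℕ, 1 ≤ m → a ^ m ∈ V) →
    ∃ N : ℕ, ∀ m : ℕ, N ≤ m → a ^ m * b ∈ V

theorem exists_ringHom_to_numberField.{v} (A : Type v) [CommRing A] [Nontrivial A] [Algebra ℚ A]
    [Algebra.FiniteType ℚ A] :
    ∃ (F : Type v) (_ : Field F) (_ : NumberField F), Nonempty (A →+* F) := by
  obtain ⟨I, hI⟩ := Ideal.exists_maximal A
  let : Field (A ⧸ I) := Ideal.Quotient.field I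
  let alg : Algebra ℚ (A ⧸ I) := Ideal.Quotient.algebra ℚ
  have : Algebra.FiniteType ℚ (A ⧸ I) :=
    Algebra.FiniteType.of_surjective (Ideal.Quotient.mkₐ ℚ I) Ideal.Quotient.mk_surjective
  have hfin : Module.Finite ℚ (A ⧸ I) := finite_of_finite_type_of_isJacobsonRing ℚ (A ⧸ I)
  have hchar : CharZero (A ⧸ I) := algebraRat.charZero (A ⧸ I)
  refine ⟨A ⧸ I, inferInstance, @NumberField.mk _ _ hchar ?_, ⟨Ideal.Quotient.mk I⟩⟩
  convert hfin
  exact Subsingleton.elim _ _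

theorem exists_primes_not_inverted {L : Type*} [Field L] [CharZero L] (S : Finset L) :
    ∃ N : ℕ, ∀ p : ℕ, p.Prime → N < p → ∀ n : ℕ, ∀ ρ ∈ Subring.closure (S : Set L),
      (n : L) = p * ρ → p ∣ n := by
  classical
  let A := Algebra.adjoin ℚ (S : Set L)
  have : Algebra.FiniteType ℚ A := (Subalgebra.fg_iff_finiteType A).1 ⟨S, rfl⟩
  obtain ⟨F, _, _, ⟨φ⟩⟩ := exists_ringHom_to_numberField A
  have hSA : ∀ s ∈ S, s ∈ A := fun s hs => Algebra.subset_adjoin hs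
  obtain ⟨y, hy, hyS⟩ := exists_integral_multiples ℤ ℚ (L := F)
    (S.attach.image fun s : S => φ ⟨(s : L), hSA s s.2⟩)
  have key : ∀ ρ ∈ Subring.closure (S : Set L), ∃ h : ρ ∈ A, ∃ k : ℕ,
      IsIntegral ℤ ((y : F) ^ k * φ ⟨ρ, h⟩) := by
    have hyi : ∀ k : ℕ, IsIntegral ℤ ((y : F) ^ k) := fun k => by
      simpa using (isIntegral_algebraMap (R := ℤ) (A := F) (x := y ^ k))
    intro ρ hρ
    induction hρ using Subring.closure_induction with
    | mem x hx =>
      refine ⟨hSA x hx, 1, ?_⟩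
      have := hyS (φ ⟨x, hSA x hx⟩) (Finset.mem_image.2 ⟨⟨x, hx⟩, Finset.mem_attach _ _, rfl⟩)
      simpa [zsmul_eq_mul] using this
    | zero => exact ⟨A.zero_mem, 0, by
        rw [show (⟨0, A.zero_mem⟩ : A) = 0 from rfl, map_zero, mul_zero]; exact isIntegral_zero⟩
    | one => exact ⟨A.one_mem, 0, by
        rw [show (⟨1, A.one_mem⟩ : A) = 1 from rfl, map_one, mul_one]; exact hyi 0⟩
    | add a b _ _ ha hb =>
      obtain ⟨ha, k, hk⟩ := ha
      obtain ⟨hb, l, hl⟩ := hb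
      refine ⟨A.add_mem ha hb, k + l, ?_⟩
      rw [show (⟨a + b, A.add_mem ha hb⟩ : A) = ⟨a, ha⟩ + ⟨b, hb⟩ from rfl, map_add]
      have hsum : (y : F) ^ (k + l) * (φ ⟨a, ha⟩ + φ ⟨b, hb⟩) =
          y ^ l * (y ^ k * φ ⟨a, ha⟩) + y ^ k * (y ^ l * φ ⟨b, hb⟩) := by ring
      rw [hsum]
      exact ((hyi l).mul hk).add ((hyi k).mul hl)
    | neg a _ ha =>
      obtain ⟨ha, k, hk⟩ := ha
      refine ⟨A.neg_mem ha, k, ?_⟩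
      rw [show (⟨-a, A.neg_mem ha⟩ : A) = -⟨a, ha⟩ from rfl, map_neg, mul_neg]
      exact hk.neg
    | mul a b _ _ ha hb =>
      obtain ⟨ha, k, hk⟩ := ha
      obtain ⟨hb, l, hl⟩ := hb
      refine ⟨A.mul_mem ha hb, k + l, ?_⟩
      rw [show (⟨a * b, A.mul_mem ha hb⟩ : A) = ⟨a, ha⟩ * ⟨b, hb⟩ from rfl, map_mul]
      rw [pow_add, mul_mul_mul_comm]
      exact hk.mul hl
  refine ⟨y.natAbs, fun p hp hNp n ρ hρ hn => ?_⟩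
  obtain ⟨h, k, hk⟩ := key ρ hρ
  have h1 : (n : F) = p * φ ⟨ρ, h⟩ := by
    have : (n : A) = p * ⟨ρ, h⟩ := Subtype.ext (by simpa using hn)
    simpa using congrArg φ this
  have hp0 : (p : F) ≠ 0 := Nat.cast_ne_zero.2 hp.ne_zero
  have h2 : (y : F) ^ k * φ ⟨ρ, h⟩ = algebraMap ℚ F ((y : ℚ) ^ k * n / p) := by
    simp only [map_div₀, map_mul, map_pow, map_intCast, map_natCast]
    rw [h1]
    field_simp
  rw [h2, isIntegral_algebraMap_iff (algebraMap ℚ F).injective] at hk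
  obtain ⟨z, hz⟩ := IsIntegrallyClosed.isIntegral_iff.1 hk
  have hp0' : (p : ℚ) ≠ 0 := Nat.cast_ne_zero.2 hp.ne_zero
  have h3 : y ^ k * n = p * z := by
    simp only [algebraMap_int_eq, eq_intCast] at hz
    rw [eq_div_iff hp0'] at hz
    have : (y : ℚ) ^ k * n = p * z := by rw [← hz]; ring
    exact_mod_cast this
  have hpz : Prime (p : ℤ) := Nat.prime_iff_prime_int.1 hp
  rcases hpz.dvd_or_dvd ⟨z, h3⟩ with h4 | h4
  · have h5 := Int.natCast_dvd.1 (hpz.dvd_of_dvd_pow h4)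
    exact absurd (Nat.le_of_dvd (Int.natAbs_pos.2 hy) h5) (not_le.2 hNp)
  · exact_mod_cast h4

theorem derivative_eq_of_comp_X_add_one_sub_eq {L : Type*} [Field L] [CharZero L] {F G : L[X]}
    (h : F.comp (X + 1) - F = G.comp (X + 1) - G) : derivative F = derivative G := by
  have hper : (F - G).comp (X + 1) = F - G := by
    rw [sub_comp]; linear_combination h
  have hval : ∀ n : ℕ, (F - G).eval (n : L) = (F - G).eval 0 := by
    intro n
    induction n with
    | zero => simp
    | succ n ih =>
      rw [← ih, ← congrArg (eval (n : L)) hper, eval_comp]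
      simp
  have hconst : F - G = C ((F - G).eval 0) := by
    refine eq_of_infinite_eval_eq _ _ ((Set.infinite_range_of_injective
      (Nat.cast_injective (R := L))).mono ?_)
    rintro _ ⟨n, rfl⟩
    simpa using hval n
  have := congrArg derivative hconst
  rw [derivative_C, derivative_sub] at this
  exact sub_eq_zero.1 this

theorem descPochhammer_succ_comp_X_add_one_sub {R : Type*} [CommRing R] (n : ℕ) :
    (descPochhammer R (n + 1)).comp (X + 1) - descPochhammer R (n + 1) =
      ((n : R[X]) + 1) * descPochhammer R n := by
  nth_rewrite 1 [descPochhammer_succ_left]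
  rw [descPochhammer_succ_right, mul_comp, comp_assoc]
  simp only [X_comp, sub_comp, one_comp, add_sub_cancel_right, comp_X]
  ring

theorem C_div_mul_descPochhammer_comp_sub {L : Type*} [Field L] [CharZero L] (n : ℕ) (a : L) :
    (C (a / (n + 1)) * descPochhammer L (n + 1)).comp (X + 1) -
      C (a / (n + 1)) * descPochhammer L (n + 1) = C a * descPochhammer L n := by
  have h : C (a / (n + 1)) * ((n : L[X]) + 1) = C a := by
    rw [← C_eq_natCast, ← C_1, ← C_add, ← C_mul, div_mul_cancel₀ _ (Nat.cast_add_one_ne_zero n)]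
  rw [mul_comp, C_comp, ← mul_sub, descPochhammer_succ_comp_X_add_one_sub, ← mul_assoc, h]

theorem eval_zero_derivative_descPochhammer_succ {R : Type*} [CommRing R] (n : ℕ) :
    (derivative (descPochhammer R (n + 1))).eval 0 = (-1) ^ n * (n.factorial : R) := by
  have h : ∀ n : ℕ, (descPochhammer R n).eval (-1) = (-1) ^ n * (n.factorial : R) := by
    intro n
    induction n with
    | zero => simp
    | succ n ih =>
      rw [descPochhammer_succ_eval, ih, Nat.factorial_succ]
      push_cast
      ring
  rw [descPochhammer_succ_left, derivative_mul, ← h]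
  simp [eval_comp]

theorem coeff_descPochhammer_mem {L : Type*} [Field L] (R : Subring L) (n i : ℕ) :
    (descPochhammer L n).coeff i ∈ R := by
  rw [← descPochhammer_map (Int.castRingHom L), coeff_map]
  exact intCast_mem R _

theorem sub_C_mul_descPochhammer {L : Type*} [Field L] (R : Subring L) {n : ℕ} {g : L[X]}
    (hdeg : g.degree < (n + 1 : ℕ)) (hg : ∀ i, g.coeff i ∈ R) :
    (g - C (g.coeff n) * descPochhammer L n).degree < n ∧
      ∀ i, (g - C (g.coeff n) * descPochhammer L n).coeff i ∈ R := by
  constructor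
  · rw [degree_lt_iff_coeff_zero] at hdeg ⊢
    intro i hi
    rw [coeff_sub, coeff_C_mul]
    rcases hi.eq_or_lt with rfl | hi
    · have := (monic_descPochhammer L n).coeff_natDegree
      rw [descPochhammer_natDegree] at this
      rw [this, mul_one, sub_self]
    · rw [hdeg i hi, coeff_eq_zero_of_natDegree_lt (p := descPochhammer L n)
        (by rwa [descPochhammer_natDegree])]
      simp
  · intro i
    rw [coeff_sub, coeff_C_mul]
    exact R.sub_mem (hg i) (R.mul_mem (hg n) (coeff_descPochhammer_mem R n i))

theorem exists_comp_X_add_one_sub_eq {L : Type*} [Field L] [CharZero L] (R : Subring L) (n : ℕ) :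
    ∀ g : L[X], g.degree < n → (∀ i, g.coeff i ∈ R) →
      ∃ F : L[X], F.comp (X + 1) - F = g ∧
        (n.factorial : L) * (derivative F).eval 0 ∈ R := by
  induction n with
  | zero =>
    intro g hg _
    exact ⟨0, by
      have : g = 0 := by simpa [Nat.WithBot.lt_zero_iff] using hg
      simp [this], by simp⟩
  | succ n ih =>
    intro g hdeg hg
    obtain ⟨hdeg', hg'⟩ := sub_C_mul_descPochhammer R hdeg hg
    obtain ⟨F, hF, hF'⟩ := ih _ hdeg' hg'
    have hn : (n : L) + 1 ≠ 0 := Nat.cast_add_one_ne_zero n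
    refine ⟨F + C (g.coeff n / (n + 1)) * descPochhammer L (n + 1), ?_, ?_⟩
    · have h := C_div_mul_descPochhammer_comp_sub n (g.coeff n)
      rw [add_comp]
      linear_combination hF + h
    · rw [derivative_add, derivative_C_mul, eval_add, eval_C_mul,
        eval_zero_derivative_descPochhammer_succ, Nat.factorial_succ]
      have : ((n + 1) * n.factorial : ℕ) * (eval 0 (derivative F) +
          g.coeff n / (n + 1) * ((-1) ^ n * (n.factorial : L))) =
          ((n + 1 : ℕ) : L) * (n.factorial * eval 0 (derivative F)) +
            n.factorial * (g.coeff n * ((-1) ^ n * n.factorial)) := by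
        push_cast
        field_simp
      rw [this]
      exact R.add_mem (R.mul_mem (natCast_mem R _) hF') (R.mul_mem (natCast_mem R _)
        (R.mul_mem (hg n) (R.mul_mem (R.pow_mem (R.neg_mem R.one_mem) _) (natCast_mem R _))))

theorem sq_factorial_mul_coeff_mem {L : Type*} [Field L] [CharZero L] (R : Subring L) {n : ℕ}
    {F g : L[X]} (hF : F.comp (X + 1) - F = g) (hF0 : (derivative F).eval 0 = 0)
    (hdeg : g.degree < (n + 1 : ℕ)) (hg : ∀ i, g.coeff i ∈ R) :
    ∃ ρ ∈ R, ((n.factorial ^ 2 : ℕ) : L) * g.coeff n = (n + 1 : ℕ) * ρ := by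
  obtain ⟨hdeg', hg'⟩ := sub_C_mul_descPochhammer R hdeg hg
  obtain ⟨G, hG, hG'⟩ := exists_comp_X_add_one_sub_eq R n _ hdeg' hg'
  have hn : (n : L) + 1 ≠ 0 := Nat.cast_add_one_ne_zero n
  have hd : derivative F =
      derivative (G + C (g.coeff n / (n + 1)) * descPochhammer L (n + 1)) := by
    apply derivative_eq_of_comp_X_add_one_sub_eq
    have h := C_div_mul_descPochhammer_comp_sub n (g.coeff n)
    rw [add_comp]
    linear_combination hF - hG - h
  rw [hd, derivative_add, derivative_C_mul, eval_add, eval_C_mul,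
    eval_zero_derivative_descPochhammer_succ] at hF0
  refine ⟨(-1) ^ (n + 1) * (n.factorial * (derivative G).eval 0),
    R.mul_mem (R.pow_mem (R.neg_mem R.one_mem) _) hG', ?_⟩
  have hsq : ((-1 : L) ^ n) * (-1) ^ n = 1 := by rw [← mul_pow]; simp
  have h3 : (derivative G).eval 0 = - (g.coeff n / (n + 1) * ((-1) ^ n * (n.factorial : L))) := by
    linear_combination hF0
  rw [h3, pow_succ]
  push_cast
  field_simp
  linear_combination (- (n.factorial : L) ^ 2 * g.coeff n) * hsq

theorem eq_zero_of_forall_pow_eq_comp_X_add_one_sub {L : Type*} [Field L] [CharZero L] {A : L[X]}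
    (h : ∀ m : ℕ, 1 ≤ m → ∃ F : L[X], F.comp (X + 1) - F = A ^ m ∧ (derivative F).eval 0 = 0) :
    A = 0 := by
  classical
  by_contra hA
  rcases Nat.eq_zero_or_pos A.natDegree with hd | hd
  · obtain ⟨F, hF, hF0⟩ := h 1 le_rfl
    have hC := eq_C_of_natDegree_eq_zero hd
    have hF' : derivative F = derivative (C (A.coeff 0) * X) := by
      apply derivative_eq_of_comp_X_add_one_sub_eq
      rw [hF, mul_comp, C_comp, X_comp, mul_add, mul_one, add_sub_cancel_left, pow_one]
      exact hC
    rw [hF', derivative_C_mul, derivative_X, mul_one, eval_C] at hF0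
    exact hA (by rw [hC, hF0, C_0])
  · let S : Finset L := insert A.leadingCoeff⁻¹ (A.support.image A.coeff)
    obtain ⟨N, hN⟩ := exists_primes_not_inverted S
    obtain ⟨p, hp, hNp, hmod⟩ := Nat.exists_prime_gt_modEq_one N hd.ne'
    obtain ⟨m, hm⟩ : A.natDegree ∣ p - 1 := (Nat.modEq_iff_dvd' hp.one_lt.le).1 hmod.symm
    have hm1 : 1 ≤ m := by
      rcases Nat.eq_zero_or_pos m with rfl | h0
      · have := hp.one_lt
        omega
      · exact h0
    let R := Subring.closure (S : Set L)
    have hcoeff : ∀ i, A.coeff i ∈ R := fun i => by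
      by_cases hi : A.coeff i = 0
      · rw [hi]
        exact R.zero_mem
      · exact Subring.subset_closure (Finset.mem_insert_of_mem
          (Finset.mem_image_of_mem _ (mem_support_iff.2 hi)))
    have hpow : ∀ i, (A ^ m).coeff i ∈ R := by
      have hlift : A ∈ lifts R.subtype :=
        (lifts_iff_coeff_lifts _).2 fun i => ⟨⟨_, hcoeff i⟩, rfl⟩
      intro i
      obtain ⟨x, hx⟩ := (lifts_iff_coeff_lifts _).1 (pow_mem hlift m) i
      rw [← hx]
      exact x.2
    obtain ⟨F, hF, hF0⟩ := h m hm1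
    have hdeg : (A ^ m).degree < (p - 1 + 1 : ℕ) := by
      rw [degree_eq_natDegree (pow_ne_zero m hA), natDegree_pow, hm, mul_comm m]
      exact_mod_cast Nat.lt_succ_self _
    obtain ⟨ρ, hρ, hρ'⟩ := sq_factorial_mul_coeff_mem R hF hF0 hdeg hpow
    have hlc : (A ^ m).coeff (p - 1) = A.leadingCoeff ^ m := by
      rw [← leadingCoeff_pow, leadingCoeff, natDegree_pow, hm, mul_comm m]
    rw [hlc, Nat.sub_add_cancel hp.one_lt.le] at hρ'
    have hinv : A.leadingCoeff⁻¹ ∈ R := Subring.subset_closure (Finset.mem_insert_self _ _)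
    have hdvd := hN p hp hNp ((p - 1).factorial ^ 2) (ρ * A.leadingCoeff⁻¹ ^ m)
      (R.mul_mem hρ (R.pow_mem hinv m)) (by
        rw [← mul_assoc, ← hρ', mul_assoc, ← mul_pow,
          mul_inv_cancel₀ (leadingCoeff_ne_zero.2 hA), one_pow, mul_one])
    have := (hp.dvd_factorial).1 (hp.dvd_of_dvd_pow hdvd)
    have := hp.one_lt
    omega

theorem eq_zero_of_forall_pow_eq_sub_comp {L : Type*} [Field L] [CharZero L] {c r : L}
    (hc : c ≠ 0) {a : L[X]}
    (h : ∀ m : ℕ, 1 ≤ m → ∃ P : L[X], P - P.comp (X + C c) = a ^ m ∧ (X - C r) ^ 2 ∣ P) :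
    a = 0 := by
  have hA : a.comp (C c * X + C r) = 0 := by
    refine eq_zero_of_forall_pow_eq_comp_X_add_one_sub fun m hm => ?_
    obtain ⟨P, hP, Q, hQ⟩ := h m hm
    refine ⟨-P.comp (C c * X + C r), ?_, ?_⟩
    · have h1 : (P.comp (C c * X + C r)).comp (X + 1) =
          (P.comp (X + C c)).comp (C c * X + C r) := by
        rw [comp_assoc, comp_assoc]
        congr 1
        simp only [add_comp, mul_comp, C_comp, X_comp]
        ring
      rw [neg_comp, h1, ← pow_comp, ← hP, sub_comp]
      ring
    · rw [hQ]
      simp [derivative_comp, eval_comp, derivative_mul, derivative_pow]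
  have h2 := congrArg (fun q : L[X] => q.comp (C c⁻¹ * (X - C r))) hA
  simp only [comp_assoc, add_comp, mul_comp, C_comp, X_comp, zero_comp] at h2
  rwa [← mul_assoc, ← C_mul, mul_inv_cancel₀ hc, C_1, one_mul, sub_add_cancel, comp_X] at h2

theorem exists_sub_comp_X_add_C_eq {K : Type*} [Field K] [CharZero K] {c : K} (hc : c ≠ 0)
    (g : K[X]) : ∃ F : K[X], F - F.comp (X + C c) = g := by
  obtain ⟨F, hF, -⟩ := exists_comp_X_add_one_sub_eq (⊤ : Subring K)
    ((g.comp (C c * X)).natDegree + 1) (g.comp (C c * X))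
    (degree_le_natDegree.trans_lt (by exact_mod_cast Nat.lt_succ_self _))
    fun _ => Subring.mem_top _
  refine ⟨-F.comp (C c⁻¹ * X), ?_⟩
  have hcc : (C c⁻¹ : K[X]) * C c = 1 := by rw [← C_mul, inv_mul_cancel₀ hc, C_1]
  have h := congrArg (fun q : K[X] => q.comp (C c⁻¹ * X)) hF
  simp only [sub_comp, comp_assoc, add_comp, mul_comp, C_comp, X_comp, one_comp] at h
  rw [← mul_assoc, mul_comm (C c), hcc, one_mul, comp_X] at h
  rw [neg_comp, comp_assoc, mul_comp, C_comp, X_comp, mul_add, hcc, ← h]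
  ring

theorem exists_sub_C_eval_dvd_of_degree_le_one {K : Type*} [Field K] {u : K[X]} (hu0 : u ≠ 0)
    (hu : u.degree ≤ 1) : ∃ r : K, ∀ F : K[X], u ∣ F - C (F.eval r) := by
  have h := eq_X_add_C_of_degree_le_one hu
  by_cases h1 : u.coeff 1 = 0
  · rw [h1, C_0, zero_mul, zero_add] at h
    have h0 : u.coeff 0 ≠ 0 := fun h0 => hu0 (by rw [h, h0, C_0])
    refine ⟨0, fun F => IsUnit.dvd ?_⟩
    rw [h]
    exact isUnit_C.2 h0.isUnit
  · refine ⟨-(u.coeff 0 / u.coeff 1), fun F => ?_⟩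
    have h2 : u = C (u.coeff 1) * (X - C (-(u.coeff 0 / u.coeff 1))) := by
      rw [mul_sub, ← C_mul, mul_neg, mul_div_cancel₀ _ h1, C_neg, sub_neg_eq_add]
      exact h
    have hunit : IsUnit (C (u.coeff 1)) := isUnit_C.2 (Ne.isUnit h1)
    have hdvd := hunit.mul_left_dvd.2
      (X_sub_C_dvd_sub_C_eval (a := -(u.coeff 0 / u.coeff 1)) (p := F))
    rwa [← h2] at hdvd

theorem isMathieuSubspace_of_forall_pow_mem_eq_zero {K : Type*} [Field K]
    {V : Submodule K K[X]} (h : ∀ a : K[X], (∀ m : ℕ, 1 ≤ m → a ^ m ∈ V) → a = 0) :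
    IsMathieuSubspace V := fun a b ha =>
  ⟨1, fun m hm => by
    rw [h a ha, zero_pow (Nat.one_le_iff_ne_zero.1 hm), zero_mul]
    exact V.zero_mem⟩

theorem LNED_case_translation {K : Type*} [Field K] [CharZero K] (c : K) (u : Polynomial K)
    (hu : u = 0 ∨ u.degree ≤ 1 ∨
      ∃ r : AlgebraicClosure K,
        (X - C r) ^ 2 ∣ u.map (algebraMap K (AlgebraicClosure K))) :
    IsMathieuSubspace (Submodule.map
      ((LinearMap.id : Polynomial K →ₗ[K] Polynomial K) - (aeval (X + C c)).toLinearMap)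
      (Submodule.restrictScalars K (Ideal.span {u}))) := by
  have hmem : ∀ f : K[X], f ∈ Submodule.map
      ((LinearMap.id : K[X] →ₗ[K] K[X]) - (aeval (X + C c)).toLinearMap)
      (Submodule.restrictScalars K (Ideal.span {u})) ↔
      ∃ P : K[X], u ∣ P ∧ P - P.comp (X + C c) = f := fun f => by
    simp [Submodule.mem_map, Ideal.mem_span_singleton, ← comp_eq_aeval]
  by_cases hc : c = 0
  · refine isMathieuSubspace_of_forall_pow_mem_eq_zero fun a ha => ?_
    obtain ⟨P, -, hP⟩ := (hmem _).1 (ha 1 le_rfl)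
    simpa [hc, eq_comm] using hP
  by_cases hu0 : u = 0
  · refine isMathieuSubspace_of_forall_pow_mem_eq_zero fun a ha => ?_
    obtain ⟨P, hP0, hP⟩ := (hmem _).1 (ha 1 le_rfl)
    rw [hu0, zero_dvd_iff] at hP0
    simpa [hP0, eq_comm] using hP
  rcases hu with hu | hu | ⟨r, hr⟩
  · exact absurd hu hu0
  · intro a b _
    refine ⟨0, fun m _ => (hmem _).2 ?_⟩
    obtain ⟨r, hr⟩ := exists_sub_C_eval_dvd_of_degree_le_one hu0 hu
    obtain ⟨F, hF⟩ := exists_sub_comp_X_add_C_eq hc (a ^ m * b)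
    refine ⟨F - C (F.eval r), hr F, ?_⟩
    rw [← hF, sub_comp, C_comp]
    ring
  · refine isMathieuSubspace_of_forall_pow_mem_eq_zero fun a ha => ?_
    let ι := algebraMap K (AlgebraicClosure K)
    have hmap : a.map ι = 0 := by
      refine eq_zero_of_forall_pow_eq_sub_comp (c := ι c) (r := r)
        ((map_ne_zero ι).2 hc) fun m hm => ?_
      obtain ⟨P, hPu, hP⟩ := (hmem _).1 (ha m hm)
      refine ⟨P.map ι, ?_, hr.trans (map_dvd (mapRingHom ι) hPu)⟩
      rw [← Polynomial.map_pow, ← hP, Polynomial.map_sub, Polynomial.map_comp]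
      simp
    exact (Polynomial.map_eq_zero ι).1 hmap
end

section
/- Let K be a field of characteristic zero and u ∈ K[x] a nonzero polynomial having at least two distinct roots in an algebraic closure of K (i.e., u is not of the form λ(x - c)^n). Then the radical of the image ∂(uK[x]) of the ideal uK[x] under the derivative ∂ = d/dx is {0}; in particular ∂(uK[x]) is a Mathieu subspace of K[x]. -/
open Polynomial

/-- The radical of a subset `V`: all elements whose high enough powers all lie in `V`. -/
def msRadical {K : Type*} [Field K] (V : Set (Polynomial K)) : Set (Polynomial K) :=
  {a : Polynomial K | ∃ N : ℕ, ∀ m : ℕ, N ≤ m → a ^ m ∈ V}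

/-- In a field of characteristic zero, a finitely generated subring contains the inverses of only
finitely many primes. -/
theorem exists_forall_prime_inv_notMem_adjoin {L : Type*} [Field L] [CharZero L] {S : Set L}
    (hS : S.Finite) :
    ∃ N : ℕ, ∀ p : ℕ, p.Prime → N < p → (p : L)⁻¹ ∉ Algebra.adjoin ℤ S := by
  set R := Algebra.adjoin ℤ S
  have hft : Algebra.FiniteType ℤ R :=
    (Subalgebra.fg_iff_finiteType _).mp (Subalgebra.fg_def.mpr ⟨S, hS, rfl⟩)
  have hfp : (algebraMap ℤ R).FinitePresentation :=
    RingHom.finitePresentation_algebraMap.mpr (Algebra.FinitePresentation.of_finiteType.mp hft)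
  obtain ⟨T, hT⟩ := PrimeSpectrum.exists_constructibleSetData_iff.mpr
    (PrimeSpectrum.isConstructible_range_comap hfp)
  have hinj : Function.Injective (algebraMap ℤ R) := (algebraMap ℤ R).injective_int
  have hbot : (⊥ : PrimeSpectrum ℤ) ∈ T.toSet := by
    rw [hT]
    refine ⟨⊥, PrimeSpectrum.ext ?_⟩
    exact (RingHom.injective_iff_ker_eq_bot _).mp hinj
  simp only [PrimeSpectrum.ConstructibleSetData.toSet, Set.mem_iUnion] at hbot
  obtain ⟨C, hC, hCg, hCf⟩ := hbot
  have hg : ∀ i, C.g i = 0 := fun i ↦ by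
    simpa [PrimeSpectrum.asIdeal_bot] using hCg ⟨i, rfl⟩
  have hf : C.f ≠ 0 := by
    simpa [PrimeSpectrum.mem_zeroLocus, PrimeSpectrum.asIdeal_bot] using hCf
  refine ⟨C.f.natAbs, fun p hp hlt hmem ↦ ?_⟩
  have hprime : (Ideal.span {(p : ℤ)}).IsPrime :=
    (Ideal.span_singleton_prime (by exact_mod_cast hp.ne_zero)).mpr
      (Nat.prime_iff_prime_int.mp hp)
  have hrange : (⟨_, hprime⟩ : PrimeSpectrum ℤ) ∈ T.toSet := by
    simp only [PrimeSpectrum.ConstructibleSetData.toSet, Set.mem_iUnion]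
    refine ⟨C, hC, ?_, ?_⟩
    · rintro _ ⟨i, rfl⟩
      simp [hg i]
    · simp only [PrimeSpectrum.mem_zeroLocus, Set.singleton_subset_iff, SetLike.mem_coe,
        Ideal.mem_span_singleton]
      intro hdvd
      exact absurd (Nat.le_of_dvd (Int.natAbs_pos.mpr hf) (Int.natCast_dvd.mp hdvd))
        (by omega)
  rw [hT] at hrange
  obtain ⟨q, hq⟩ := hrange
  have hpq : (algebraMap ℤ R) p ∈ q.asIdeal := by
    have h : (p : ℤ) ∈ (PrimeSpectrum.comap (algebraMap ℤ R) q).asIdeal := by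
      rw [hq]
      exact Ideal.mem_span_singleton_self _
    exact h
  refine q.isPrime.ne_top (Ideal.eq_top_of_isUnit_mem _ hpq (.of_mul_eq_one ⟨_, hmem⟩ ?_))
  apply Subtype.ext
  have : (p : L) ≠ 0 := by exact_mod_cast hp.ne_zero
  simp [this]

/-- If an antiderivative `H` of `q` takes equal values at `0` and `1`, then the termwise integral
of `q` over `[0, 1]` vanishes. -/
theorem sum_coeff_div_eq_zero_of_eval_zero_eq_eval_one {L : Type*} [Field L] [CharZero L]
    {H q : L[X]} (hH : derivative H = q) (h01 : H.eval 0 = H.eval 1) {n : ℕ}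
    (hn : q.natDegree < n) : ∑ k ∈ Finset.range n, q.coeff k / (k + 1) = 0 := by
  have hcoeff (k : ℕ) : q.coeff k / (k + 1) = H.coeff (k + 1) := by
    rw [← hH, coeff_derivative, mul_div_cancel_right₀ _ (Nat.cast_add_one_ne_zero k)]
  have hdeg : H.natDegree < n + 1 := by
    refine Nat.lt_succ_of_le (natDegree_le_iff_coeff_eq_zero.mpr fun k hk ↦ ?_)
    obtain ⟨k, rfl⟩ := Nat.exists_eq_succ_of_ne_zero (Nat.ne_zero_of_lt hk)
    rw [Nat.succ_eq_add_one, ← hcoeff, coeff_eq_zero_of_natDegree_lt (by omega), zero_div]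
  rw [eval_eq_sum_range' hdeg 1, Finset.sum_range_succ', ← coeff_zero_eq_eval_zero] at h01
  simpa [hcoeff] using h01

/-- If the termwise integral of `h ^ m` over `[0, 1]` vanishes and `p = m * deg h + 1` is prime,
then `p` is invertible in the ring generated by the coefficients of `h` and the inverse of its leading
coefficient. -/
theorem prime_inv_mem_adjoin_of_sum_coeff_div_eq_zero {L : Type*} [Field L] [CharZero L]
    {h : L[X]} (h0 : h ≠ 0) {m p : ℕ} (hp : p.Prime) (hmp : m * h.natDegree + 1 = p)
    (hsum : ∑ k ∈ Finset.range p, (h ^ m).coeff k / (k + 1) = 0) :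
    (p : L)⁻¹ ∈ Algebra.adjoin ℤ (insert h.leadingCoeff⁻¹ (h.coeffs : Set L)) := by
  set R := Algebra.adjoin ℤ (insert h.leadingCoeff⁻¹ (h.coeffs : Set L))
  have hlc : h.leadingCoeff ≠ 0 := leadingCoeff_ne_zero.mpr h0
  have hp0 : (p : L) ≠ 0 := by exact_mod_cast hp.ne_zero
  have hinv : h.leadingCoeff⁻¹ ∈ R := Algebra.subset_adjoin (Set.mem_insert _ _)
  have hlift : h ∈ lifts R.toSubring.subtype := by
    rw [lifts_iff_coeff_lifts]
    intro k
    by_cases hk : h.coeff k = 0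
    · exact ⟨0, by simp [hk]⟩
    · exact ⟨⟨_, Algebra.subset_adjoin (Set.mem_insert_of_mem _ (coeff_mem_coeffs hk))⟩, rfl⟩
  have hcoeff (k : ℕ) : (h ^ m).coeff k ∈ R := by
    obtain ⟨c, hc⟩ := (lifts_iff_coeff_lifts _).mp (pow_mem hlift m) k
    exact hc ▸ c.2
  have hfac : ((p - 1).factorial : L) * (p : L)⁻¹ ∈ R := by
    have hlast : (h ^ m).coeff (p - 1) = h.leadingCoeff ^ m := by
      rw [← hmp, Nat.add_sub_cancel, coeff_pow_mul_natDegree]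
    have hp1 : p = p - 1 + 1 := by omega
    rw [hp1, Finset.sum_range_succ, hlast, ← Nat.cast_add_one, ← hp1] at hsum
    have hmem : ((p - 1).factorial : L) *
        ∑ k ∈ Finset.range (p - 1), (h ^ m).coeff k / (k + 1) ∈ R := by
      rw [Finset.mul_sum]
      refine sum_mem fun k hk ↦ ?_
      obtain ⟨c, hc⟩ := Nat.dvd_factorial k.succ_pos (Finset.mem_range.mp hk)
      have hk0 : (k : L) + 1 ≠ 0 := Nat.cast_add_one_ne_zero k
      have : ((p - 1).factorial : L) * ((h ^ m).coeff k / (k + 1)) = c * (h ^ m).coeff k := by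
        rw [hc]
        push_cast
        field_simp
      rw [this]
      exact mul_mem (natCast_mem R c) (hcoeff k)
    have heq : ((p - 1).factorial : L) * (p : L)⁻¹ = -(h.leadingCoeff⁻¹ ^ m *
        (((p - 1).factorial : L) *
          ∑ k ∈ Finset.range (p - 1), (h ^ m).coeff k / (k + 1))) := by
      rw [eq_neg_of_add_eq_zero_left hsum, inv_pow]
      field_simp
    rw [heq]
    exact neg_mem (mul_mem (pow_mem hinv m) hmem)
  have hcop : IsCoprime ((p - 1).factorial : ℤ) (p : ℤ) := by
    rw [Nat.isCoprime_iff_coprime, Nat.coprime_comm, hp.coprime_iff_not_dvd, hp.dvd_factorial]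
    have := hp.pos
    omega
  obtain ⟨a, b, hab⟩ := hcop
  have habL : (a : L) * (p - 1).factorial + b * p = 1 := by
    exact_mod_cast congrArg (Int.cast (R := L)) hab
  have heq : (p : L)⁻¹ = a * ((p - 1).factorial * (p : L)⁻¹) + b := by
    field_simp
    linear_combination -habL
  rw [heq]
  exact add_mem (mul_mem (intCast_mem R a) hfac) (intCast_mem R b)

/-- If all high powers of `h` have integral zero over `[0, 1]`, then `h = 0`. -/
theorem eq_zero_of_forall_pow_integral_zero_one_eq_zero {L : Type*} [Field L] [CharZero L]
    {h : L[X]} {N : ℕ}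
    (hN : ∀ m, N ≤ m → ∃ H : L[X], derivative H = h ^ m ∧ H.eval 0 = H.eval 1) : h = 0 := by
  by_contra h0
  have hsum {m n : ℕ} (hm : N ≤ m) (hn : m * h.natDegree + 1 = n) :
      ∑ k ∈ Finset.range n, (h ^ m).coeff k / (k + 1) = 0 := by
    obtain ⟨H, hH, h01⟩ := hN m hm
    exact sum_coeff_div_eq_zero_of_eval_zero_eq_eval_one hH h01 (by rw [natDegree_pow]; omega)
  rcases eq_or_ne h.natDegree 0 with hd | hd
  · obtain ⟨c, rfl⟩ := natDegree_eq_zero.mp hd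
    have := hsum (m := N) (n := 1) le_rfl (by simp)
    have hc : c ^ N = 0 := by
      simpa only [← C_pow, Finset.sum_range_one, coeff_C_zero, Nat.cast_zero, zero_add, div_one]
        using this
    exact h0 (by simp [eq_zero_of_pow_eq_zero hc])
  · obtain ⟨M, hM⟩ := exists_forall_prime_inv_notMem_adjoin
      ((h.coeffs.finite_toSet).insert h.leadingCoeff⁻¹)
    obtain ⟨p, hp, hlt, hmod⟩ := Nat.exists_prime_gt_modEq_one (max M (N * h.natDegree)) hd
    obtain ⟨m, hm⟩ := (Nat.modEq_iff_dvd' hp.one_lt.le).mp hmod.symm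
    have hmp : m * h.natDegree + 1 = p := by
      rw [mul_comm, ← hm]
      have := hp.pos
      omega
    have hNm : N ≤ m := by
      refine Nat.le_of_mul_le_mul_right (c := h.natDegree) ?_ (Nat.pos_of_ne_zero hd)
      have := lt_of_le_of_lt (le_max_right _ _) hlt
      omega
    exact hM p hp (lt_of_le_of_lt (le_max_left _ _) hlt)
      (prime_inv_mem_adjoin_of_sum_coeff_div_eq_zero h0 hp hmp (hsum hNm hmp))

/-- If all high powers of `f` have antiderivatives taking equal values at two distinct points
`r` and `s`, then `f = 0`. -/
theorem eq_zero_of_forall_pow_integral_eq_zero {L : Type*} [Field L] [CharZero L]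
    {f : L[X]} {r s : L} (hrs : r ≠ s) {N : ℕ}
    (hN : ∀ m, N ≤ m → ∃ F : L[X], derivative F = f ^ m ∧ F.eval r = F.eval s) : f = 0 := by
  have hsr : s - r ≠ 0 := sub_ne_zero.mpr hrs.symm
  have hcomp : f.comp (C (s - r) * X + C r) = 0 := by
    refine eq_zero_of_forall_pow_integral_zero_one_eq_zero (N := N) fun m hm ↦ ?_
    obtain ⟨F, hF, hFrs⟩ := hN m hm
    refine ⟨C (s - r)⁻¹ * F.comp (C (s - r) * X + C r), ?_, ?_⟩
    · rw [derivative_C_mul, derivative_comp, hF]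
      simp only [derivative_add, derivative_C_mul, derivative_X, derivative_C, mul_one, add_zero,
        pow_comp]
      rw [← mul_assoc, ← C_mul, inv_mul_cancel₀ hsr, C_1, one_mul]
    · simp [hFrs]
  rcases comp_eq_zero_iff.mp hcomp with h | ⟨-, h⟩
  · exact h
  · have := congrArg (coeff · 1) h
    simp [hsr] at this

theorem radical_of_derivative_image {K : Type*} [Field K] [CharZero K] (u : Polynomial K)
    (hu : u ≠ 0)
    (hroots : ∃ r s : AlgebraicClosure K, r ≠ s ∧
      (u.map (algebraMap K (AlgebraicClosure K))).IsRoot r ∧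
      (u.map (algebraMap K (AlgebraicClosure K))).IsRoot s) :
    msRadical ((Submodule.map (derivative : Polynomial K →ₗ[K] Polynomial K)
        (Submodule.restrictScalars K (Ideal.span {u})) : Submodule K (Polynomial K)) :
          Set (Polynomial K)) = {0} ∧
    IsMathieuSubspace (Submodule.map (derivative : Polynomial K →ₗ[K] Polynomial K)
      (Submodule.restrictScalars K (Ideal.span {u}))) := by
  obtain ⟨r, s, hrs, hr, hs⟩ := hroots
  have hzero : ∀ (f : K[X]) (N : ℕ), (∀ m, N ≤ m → f ^ m ∈
      Submodule.map (derivative : K[X] →ₗ[K] K[X])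
        (Submodule.restrictScalars K (Ideal.span {u}))) → f = 0 := by
    intro f N hf
    rw [← Polynomial.map_eq_zero (algebraMap K (AlgebraicClosure K))]
    refine eq_zero_of_forall_pow_integral_eq_zero hrs (N := N) fun m hm ↦ ?_
    obtain ⟨v, hv, hvf⟩ := hf m hm
    obtain ⟨g, rfl⟩ := Ideal.mem_span_singleton.mp hv
    refine ⟨(u * g).map (algebraMap K (AlgebraicClosure K)), ?_, ?_⟩
    · rw [derivative_map, hvf, Polynomial.map_pow]
    · rw [Polynomial.map_mul, eval_mul, eval_mul, hr.eq_zero, hs.eq_zero, zero_mul, zero_mul]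
  refine ⟨Set.eq_singleton_iff_unique_mem.mpr ⟨⟨1, fun m hm ↦ ?_⟩, ?_⟩, fun a b hab ↦ ?_⟩
  · rw [zero_pow (by omega)]
    exact zero_mem _
  · rintro f ⟨N, hN⟩
    exact hzero f N hN
  · obtain rfl := hzero a 1 hab
    refine ⟨1, fun m hm ↦ ?_⟩
    rw [zero_pow (by omega), zero_mul]
    exact zero_mem _
end

section
/- Let K be a field (of arbitrary characteristic), w(x) ∈ K[x] with deg w ≥ 2, φ the K-algebra endomorphism of K[x] mapping x to w(x), and δ = I - φ. If f ∈ K[x] satisfies f ∈ Im δ, f^2 ∈ Im δ and f^3 ∈ Im δ, then f = 0. Consequently the radical of Im δ is {0}, and δ maps every K-subspace of K[x] to a Mathieu subspace of K[x]. -/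
open Polynomial

section CompDefect

variable {K : Type*} [Field K]

/-- The linear map `p ↦ p - p(w)` on `K[X]`. -/
noncomputable abbrev compDefect (w : K[X]) : K[X] →ₗ[K] K[X] :=
  LinearMap.id - (aeval w).toLinearMap

lemma compDefect_apply (w p : K[X]) : compDefect w p = p - p.comp w := rfl

/-- An element is congruent to its composition with `w` modulo the image of `compDefect w`. -/
lemma mem_range_of_comp_mem_range {w e : K[X]} (h : e.comp w ∈ LinearMap.range (compDefect w)) :
    e ∈ LinearMap.range (compDefect w) := by
  have := add_mem (LinearMap.mem_range_self (compDefect w) e) h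
  rwa [compDefect_apply, sub_add_cancel] at this

lemma natDegree_le_of_natDegree_compDefect_le {w s : K[X]} (hw : 2 ≤ w.natDegree) {m : ℕ}
    (h : (compDefect w s).natDegree ≤ w.natDegree * m) : s.natDegree ≤ m := by
  by_contra! hlt
  have hcomp : s.comp w = s - compDefect w s := by rw [compDefect_apply]; ring
  have hle := natDegree_sub_le s (compDefect w s)
  rw [← hcomp, natDegree_comp] at hle
  rcases le_max_iff.mp hle with h' | h'
  · nlinarith
  · nlinarith

/-- If `s(w)` and `g * h(w)` agree up to degree `deg h(w)`, then `g` is, up to a constant,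
a polynomial in `w`. -/
lemma exists_eq_comp_add_C {w s g h : K[X]} (hw : 2 ≤ w.natDegree) (hh : h ≠ 0)
    (hdeg : (s.comp w - g * h.comp w).natDegree ≤ w.natDegree * h.natDegree) :
    ∃ (a : K[X]) (c : K), g = a.comp w + C c := by
  have hhw : h.comp w ≠ 0 := by
    intro h0
    rcases comp_eq_zero_iff.mp h0 with h1 | ⟨-, h1⟩
    · exact hh h1
    · rw [h1, natDegree_C] at hw
      omega
  have hmod : (s % h).natDegree ≤ h.natDegree :=
    natDegree_le_natDegree (EuclideanDomain.mod_lt s hh).le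
  have hs : s.comp w = h.comp w * (s / h).comp w + (s % h).comp w := by
    rw [← mul_comp, ← add_comp, EuclideanDomain.div_add_mod]
  have hprod : h.comp w * (g - (s / h).comp w)
      = (s % h).comp w - (s.comp w - g * h.comp w) := by
    rw [hs]; ring
  have hle : (h.comp w * (g - (s / h).comp w)).natDegree ≤ w.natDegree * h.natDegree := by
    rw [hprod]
    refine (natDegree_sub_le _ _).trans (max_le ?_ hdeg)
    rw [natDegree_comp, mul_comm]
    gcongr
  have hzero : (g - (s / h).comp w).natDegree = 0 := by
    by_cases h0 : g - (s / h).comp w = 0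
    · rw [h0, natDegree_zero]
    · rw [natDegree_mul hhw h0, natDegree_comp, mul_comm h.natDegree] at hle
      omega
  obtain ⟨c, hc⟩ := natDegree_eq_zero.mp hzero
  exact ⟨s / h, c, by rw [hc]; ring⟩

/-- Descent: a property invariant under adding constants, and under which a polynomial is a
composition with `w` up to a constant, with the property passing to the outer factor, holds for
constants only. -/
lemma natDegree_eq_zero_of_descent {w : K[X]} (hw : 2 ≤ w.natDegree) {P : K[X] → Prop}
    (hadd : ∀ g c, P g → P (g + C c))
    (hcomp : ∀ g, P g → ∃ (a : K[X]) (c : K), g = a.comp w + C c)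
    (hout : ∀ a : K[X], P (a.comp w) → P a) (g : K[X]) (hg : P g) : g.natDegree = 0 := by
  induction hn : g.natDegree using Nat.strong_induction_on generalizing g with
  | _ n ih =>
    obtain ⟨a, c, rfl⟩ := hcomp g hg
    have ha : P a := by
      apply hout
      simpa [add_assoc, ← C_add] using hadd _ (-c) hg
    rw [natDegree_add_C, natDegree_comp] at hn
    by_contra hne
    have hpos : 0 < a.natDegree := by
      refine Nat.pos_of_ne_zero fun h0 => hne ?_
      rw [← hn, h0, zero_mul]
    exact hpos.ne' (ih a.natDegree (by nlinarith) a ha rfl)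

lemma natDegree_eq_zero_of_mul_compDefect_mem {w : K[X]} (hw : 2 ≤ w.natDegree) (g : K[X])
    (hg : g * compDefect w g ∈ LinearMap.range (compDefect w)) : g.natDegree = 0 := by
  refine natDegree_eq_zero_of_descent hw
    (P := fun g => g * compDefect w g ∈ LinearMap.range (compDefect w)) ?_ ?_ ?_ g hg
  · intro g c h
    have h' := add_mem h (Submodule.smul_mem _ c (LinearMap.mem_range_self (compDefect w) g))
    convert h' using 1
    simp only [compDefect_apply, smul_eq_C_mul, add_comp, C_comp]
    ring
  · rintro g ⟨s, hs⟩
    rcases eq_or_ne g 0 with rfl | hg0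
    · exact ⟨0, 0, by simp⟩
    have hsdeg : s.natDegree ≤ 2 * g.natDegree := by
      apply natDegree_le_of_natDegree_compDefect_le hw
      rw [hs, compDefect_apply]
      refine natDegree_mul_le.trans ?_
      have := natDegree_sub_le g (g.comp w)
      rw [natDegree_comp] at this
      rcases le_max_iff.mp this with h' | h' <;> nlinarith
    refine exists_eq_comp_add_C (s := s) hw hg0 ?_
    have : s.comp w - g * g.comp w = s - g ^ 2 := by
      simp only [compDefect_apply] at hs
      linear_combination -hs
    rw [this]
    refine (natDegree_sub_le _ _).trans (max_le ?_ ?_)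
    · nlinarith
    · rw [natDegree_pow]
      gcongr
  · intro a h
    apply mem_range_of_comp_mem_range
    simpa only [compDefect_apply, mul_comp, sub_comp] using h

lemma natDegree_eq_zero_of_mul_comp_mul_compDefect_mem {w : K[X]} (hw : 2 ≤ w.natDegree)
    (g : K[X]) (hg : g * g.comp w * compDefect w g ∈ LinearMap.range (compDefect w)) :
    g.natDegree = 0 := by
  refine natDegree_eq_zero_of_descent hw
    (P := fun g => g * g.comp w * compDefect w g ∈ LinearMap.range (compDefect w)) ?_ ?_ ?_ g hg
  · intro g c h
    have h' := add_mem (add_mem h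
      (Submodule.smul_mem _ c (LinearMap.mem_range_self (compDefect w) (g ^ 2))))
      (Submodule.smul_mem _ (c ^ 2) (LinearMap.mem_range_self (compDefect w) g))
    convert h' using 1
    simp only [compDefect_apply, smul_eq_C_mul, add_comp, C_comp, pow_comp, C_pow]
    ring
  · rintro g ⟨s, hs⟩
    rcases eq_or_ne g 0 with rfl | hg0
    · exact ⟨0, 0, by simp⟩
    have hsdeg : s.natDegree ≤ 3 * g.natDegree := by
      apply natDegree_le_of_natDegree_compDefect_le hw
      rw [hs, compDefect_apply]
      refine natDegree_mul_le.trans ?_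
      have h₁ := natDegree_sub_le g (g.comp w)
      have h₂ := natDegree_mul_le (p := g) (q := g.comp w)
      rw [natDegree_comp] at h₁ h₂
      rcases le_max_iff.mp h₁ with h' | h' <;> nlinarith
    refine exists_eq_comp_add_C (s := s) (h := g ^ 2) hw (pow_ne_zero 2 hg0) ?_
    have : s.comp w - g * (g ^ 2).comp w = s - g ^ 2 * g.comp w := by
      simp only [compDefect_apply] at hs
      rw [pow_comp]
      linear_combination -hs
    rw [this, natDegree_pow]
    refine (natDegree_sub_le _ _).trans (max_le ?_ ?_)
    · nlinarith
    · refine natDegree_mul_le.trans ?_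
      rw [natDegree_pow, natDegree_comp]
      nlinarith
  · intro a h
    apply mem_range_of_comp_mem_range
    simpa only [compDefect_apply, mul_comp, sub_comp] using h

theorem eq_zero_of_pow_mem_range_compDefect {w : K[X]} (hw : 2 ≤ w.natDegree) {f : K[X]}
    (h₁ : f ∈ LinearMap.range (compDefect w)) (h₂ : f ^ 2 ∈ LinearMap.range (compDefect w))
    (h₃ : f ^ 3 ∈ LinearMap.range (compDefect w)) : f = 0 := by
  obtain ⟨g, rfl⟩ := h₁
  suffices hg : g.natDegree = 0 by
    obtain ⟨c, rfl⟩ := natDegree_eq_zero.mp hg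
    rw [compDefect_apply, C_comp, sub_self]
  by_cases h2 : (2 : K) = 0
  · have h3 : (3 : K) ≠ 0 := fun h3 => one_ne_zero (by linear_combination h3 - h2 : (1 : K) = 0)
    apply natDegree_eq_zero_of_mul_comp_mul_compDefect_mem hw
    rw [← Submodule.smul_mem_iff _ h3]
    convert sub_mem (LinearMap.mem_range_self (compDefect w) (g ^ 3)) h₃ using 1
    simp only [compDefect_apply, smul_eq_C_mul, pow_comp, map_ofNat]
    ring
  · apply natDegree_eq_zero_of_mul_compDefect_mem hw
    rw [← Submodule.smul_mem_iff _ h2]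
    convert add_mem (LinearMap.mem_range_self (compDefect w) (g ^ 2)) h₂ using 1
    simp only [compDefect_apply, smul_eq_C_mul, pow_comp, map_ofNat]
    ring

end CompDefect

theorem deg_ge_two_case {K : Type*} [Field K] (w : Polynomial K) (hw : 2 ≤ w.degree) :
    (∀ f : Polynomial K,
      f ∈ LinearMap.range ((LinearMap.id : Polynomial K →ₗ[K] Polynomial K) -
        (aeval w).toLinearMap) →
      f ^ 2 ∈ LinearMap.range ((LinearMap.id : Polynomial K →ₗ[K] Polynomial K) -
        (aeval w).toLinearMap) →
      f ^ 3 ∈ LinearMap.range ((LinearMap.id : Polynomial K →ₗ[K] Polynomial K) -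
        (aeval w).toLinearMap) →
      f = 0) ∧
    msRadical ((LinearMap.range ((LinearMap.id : Polynomial K →ₗ[K] Polynomial K) -
        (aeval w).toLinearMap) : Submodule K (Polynomial K)) : Set (Polynomial K)) = {0} ∧
    ∀ V : Submodule K (Polynomial K),
      IsMathieuSubspace (Submodule.map
        ((LinearMap.id : Polynomial K →ₗ[K] Polynomial K) - (aeval w).toLinearMap) V) := by
  have hw' : 2 ≤ w.natDegree := le_natDegree_of_coe_le_degree hw
  refine ⟨fun f h₁ h₂ h₃ => eq_zero_of_pow_mem_range_compDefect hw' h₁ h₂ h₃, ?_, ?_⟩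
  · ext a
    simp only [msRadical, Set.mem_ofPred_eq, Set.mem_singleton_iff, SetLike.mem_coe]
    constructor
    · rintro ⟨N, hN⟩
      refine eq_zero_of_pow_eq_zero (n := N + 1) ?_
      refine eq_zero_of_pow_mem_range_compDefect hw' (hN _ (by omega)) ?_ ?_ <;>
      · rw [← pow_mul]
        exact hN _ (by omega)
    · rintro rfl
      refine ⟨1, fun m hm => ?_⟩
      rw [zero_pow (by omega)]
      exact zero_mem _
  · intro V a b h
    have hmem (m : ℕ) (hm : 1 ≤ m) : a ^ m ∈ LinearMap.range (compDefect w) :=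
      LinearMap.map_le_range (h m hm)
    have ha : a = 0 := eq_zero_of_pow_mem_range_compDefect hw'
      (by simpa using hmem 1 le_rfl) (hmem 2 (by omega)) (hmem 3 (by omega))
    refine ⟨1, fun m hm => ?_⟩
    rw [ha, zero_pow (by omega), zero_mul]
    exact zero_mem _
end
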